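/- arXiv:1912.01450 — 3 statements merged into one kernel-verified Lean document; each statement's English description precedes it below -/
import Mathlib

section
/- Let p ≥ 1, λ ≥ 0, b ∈ ℝ^p, and suppose w* ∈ ℝ^p has exactly k nonzero entries and satisfies ‖b − w*‖_∞ ≤ λ. If ŵ is any minimizer of ‖θ‖₁ over {θ : ‖θ − b‖_∞ ≤ λ}, then ‖ŵ − w*‖₂ ≤ 4√k · λ. -/
/-- The difference of two vectors, one of which has no larger `ℓ¹` norm than the other, and which
are coordinatewise within `c`, has `ℓ¹` norm at most `2c` times the support size of the latter. -/
theorem sum_abs_sub_le_of_sum_abs_le {ι : Type*} [Fintype ι] {u w : ι → ℝ} {c : ℝ}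
    (hc : ∀ i, |u i - w i| ≤ c) (hmin : ∑ i, |u i| ≤ ∑ i, |w i|) :
    ∑ i, |u i - w i| ≤ 2 * c * (Set.ncard {i | w i ≠ 0} : ℝ) := by
  classical
  have hpt : ∀ i, |u i - w i| ≤ |u i| - |w i| + if w i ≠ 0 then 2 * c else 0 := by
    intro i
    by_cases hi : w i = 0
    · simp [hi]
    · have h := abs_sub_abs_le_abs_sub (w i) (u i)
      rw [abs_sub_comm] at h
      rw [if_pos hi]
      linarith [hc i]
  have hcard : ∑ i, (if w i ≠ 0 then 2 * c else 0) = 2 * c * (Set.ncard {i | w i ≠ 0} : ℝ) := by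
    rw [← Finset.sum_filter, Finset.sum_const, nsmul_eq_mul, Set.ncard_eq_toFinset_card',
      Set.toFinset_ofPred, mul_comm]
  have hsum := Finset.sum_le_sum fun i (_ : i ∈ Finset.univ) => hpt i
  rw [Finset.sum_add_distrib, Finset.sum_sub_distrib, hcard] at hsum
  linarith

/-- If w* has exactly k nonzero entries and is feasible
(‖b − w*‖_∞ ≤ λ), then any minimizer ŵ of ‖θ‖₁ over {θ : ‖θ − b‖_∞ ≤ λ} satisfies
‖ŵ − w*‖₂ ≤ 4 √k · λ. -/
theorem ee_l2_error_bound {p : ℕ} (hp : 1 ≤ p) (lam : ℝ) (hlam : 0 ≤ lam)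
    (b wstar what : Fin p → ℝ) (k : ℕ)
    (hsparse : Set.ncard {i : Fin p | wstar i ≠ 0} = k)
    (hfeas : (⨆ i : Fin p, |b i - wstar i|) ≤ lam)
    (hwhat_feas : (⨆ i : Fin p, |what i - b i|) ≤ lam)
    (hwhat_min : ∀ θ : Fin p → ℝ, (⨆ i : Fin p, |θ i - b i|) ≤ lam →
      (∑ i, |what i|) ≤ ∑ i, |θ i|) :
    Real.sqrt (∑ i, (what i - wstar i) ^ 2) ≤ 4 * Real.sqrt k * lam := by
  have le_of_iSup : ∀ {f : Fin p → ℝ}, (⨆ i, f i) ≤ lam → ∀ i, f i ≤ lam := fun {f} h i =>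
    (le_ciSup (Set.finite_range f).bddAbove i).trans h
  have hc : ∀ i, |what i - wstar i| ≤ 2 * lam := fun i => by
    linarith [abs_sub_le (what i) (b i) (wstar i), le_of_iSup hwhat_feas i, le_of_iSup hfeas i]
  have hl1 := sum_abs_sub_le_of_sum_abs_le hc
    (hwhat_min wstar (by simpa only [abs_sub_comm] using hfeas))
  rw [hsparse] at hl1
  have hl2 : ∑ i, (what i - wstar i) ^ 2 ≤ 2 * lam * ∑ i, |what i - wstar i| := by
    rw [Finset.mul_sum]
    refine Finset.sum_le_sum fun i _ => ?_
    rw [← sq_abs, sq]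
    exact mul_le_mul_of_nonneg_right (hc i) (abs_nonneg _)
  refine Real.sqrt_le_iff.mpr ⟨by positivity, ?_⟩
  rw [mul_pow, mul_pow, Real.sq_sqrt k.cast_nonneg]
  have hmul := mul_le_mul_of_nonneg_left hl1 (by positivity : 0 ≤ 2 * lam)
  have hnonneg : 0 ≤ (k : ℝ) * lam ^ 2 := by positivity
  linarith
end

section
/- Let p ≥ 1, λ ≥ 0, b ∈ ℝ^p, and suppose w* ∈ ℝ^p has exactly k nonzero entries and satisfies ‖b − w*‖_∞ ≤ λ. If ŵ is any minimizer of ‖θ‖₁ over {θ : ‖θ − b‖_∞ ≤ λ}, then ‖ŵ − w*‖₁ ≤ 8k · λ. -/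
/-- If w* has exactly k nonzero entries and is feasible
(‖b − w*‖_∞ ≤ λ), then any minimizer ŵ of ‖θ‖₁ over {θ : ‖θ − b‖_∞ ≤ λ} satisfies
‖ŵ − w*‖₁ ≤ 8k · λ. -/
theorem ee_l1_error_bound {p : ℕ} (hp : 1 ≤ p) (lam : ℝ) (hlam : 0 ≤ lam)
    (b wstar what : Fin p → ℝ) (k : ℕ)
    (hsparse : Set.ncard {i : Fin p | wstar i ≠ 0} = k)
    (hfeas : (⨆ i : Fin p, |b i - wstar i|) ≤ lam)
    (hwhat_feas : (⨆ i : Fin p, |what i - b i|) ≤ lam)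
    (hwhat_min : ∀ θ : Fin p → ℝ, (⨆ i : Fin p, |θ i - b i|) ≤ lam →
      (∑ i, |what i|) ≤ ∑ i, |θ i|) :
    ∑ i, |what i - wstar i| ≤ 8 * k * lam := by
  have coord {f : Fin p → ℝ} (hf : (⨆ i, f i) ≤ lam) (i : Fin p) : f i ≤ lam :=
    (le_ciSup (Set.finite_range f).bddAbove i).trans hf
  have hmin : ∑ i, |what i| ≤ ∑ i, |wstar i| :=
    hwhat_min wstar (by simpa only [abs_sub_comm] using hfeas)
  have hcard : ((Finset.univ.filter fun i => wstar i ≠ 0).card : ℝ) = k := by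
    rw [← hsparse, ← Set.ncard_coe_finset]
    simp
  have hpoint (i : Fin p) : |what i - wstar i| ≤
      (if wstar i ≠ 0 then 4 * lam else 0) + (|what i| - |wstar i|) := by
    split_ifs with h
    · have h₁ := abs_sub_le (what i) (b i) (wstar i)
      have h₂ := coord hwhat_feas i
      have h₃ := coord hfeas i
      have h₄ := abs_sub_abs_le_abs_sub (wstar i) (what i)
      rw [abs_sub_comm (wstar i)] at h₄
      linarith
    · simp [not_not.mp h]
  have hsum := Finset.sum_le_sum fun i (_ : i ∈ Finset.univ) => hpoint i
  rw [Finset.sum_add_distrib, Finset.sum_sub_distrib, ← Finset.sum_filter,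
    Finset.sum_const, nsmul_eq_mul, hcard] at hsum
  have hk : 0 ≤ (k : ℝ) * lam := by positivity
  linarith
end

section
/- Let p ≥ 1, λ ≥ 0, b ∈ ℝ^p, and suppose w* ∈ ℝ^p has exactly k nonzero entries and satisfies ‖b − w*‖_∞ ≤ λ. Then the soft-thresholded estimate ŵ = S_λ(b) satisfies the sharper bounds ‖ŵ − w*‖₂ ≤ 2√k · λ and ‖ŵ − w*‖₁ ≤ 2k · λ. -/
/-- Coordinatewise soft-thresholding operator on ℝ^p:
`[S_λ(u)]_i = sign(u_i) · max(|u_i| − λ, 0)`. -/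
noncomputable def softThresh {p : ℕ} (lam : ℝ) (u : Fin p → ℝ) : Fin p → ℝ :=
  fun i => Real.sign (u i) * max (|u i| - lam) 0

theorem abs_softThresh_sub_self_le {p : ℕ} {lam : ℝ} (hlam : 0 ≤ lam) (u : Fin p → ℝ)
    (i : Fin p) : |softThresh lam u i - u i| ≤ lam := by
  unfold softThresh
  rcases lt_trichotomy (u i) 0 with h | h | h
  · rw [Real.sign_of_neg h, abs_of_neg h, abs_le]
    rcases max_cases (-u i - lam) 0 with h' | h' <;> constructor <;> linarith
  · simpa [h] using hlam
  · rw [Real.sign_of_pos h, abs_of_pos h, abs_le]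
    rcases max_cases (u i - lam) 0 with h' | h' <;> constructor <;> linarith

theorem softThresh_eq_zero {p : ℕ} {lam : ℝ} {u : Fin p → ℝ} {i : Fin p} (h : |u i| ≤ lam) :
    softThresh lam u i = 0 := by
  simp [softThresh, max_eq_right (sub_nonpos.2 h)]

/-- The error of soft-thresholding is supported on the support of the target, and is at most
`2 * lam` there. -/
theorem abs_softThresh_sub_le_ite {p : ℕ} {lam : ℝ} (hlam : 0 ≤ lam) {u w : Fin p → ℝ} {i : Fin p}
    (h : |u i - w i| ≤ lam) :
    |softThresh lam u i - w i| ≤ if w i ≠ 0 then 2 * lam else 0 := by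
  split_ifs with hw
  · linarith [abs_softThresh_sub_self_le hlam u i,
      abs_sub_le (softThresh lam u i) (u i) (w i)]
  · rw [not_not] at hw
    rw [hw, sub_zero] at h
    simp [hw, softThresh_eq_zero h]

/-- If w* has exactly k nonzero entries and ‖b − w*‖_∞ ≤ λ, then the
soft-thresholded estimate ŵ = S_λ(b) satisfies ‖ŵ − w*‖₂ ≤ 2 √k · λ and
‖ŵ − w*‖₁ ≤ 2k · λ. -/
theorem softThresh_sharper_bounds {p : ℕ} (hp : 1 ≤ p) (lam : ℝ) (hlam : 0 ≤ lam)
    (b wstar : Fin p → ℝ) (k : ℕ)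
    (hsparse : Set.ncard {i : Fin p | wstar i ≠ 0} = k)
    (hfeas : (⨆ i : Fin p, |b i - wstar i|) ≤ lam) :
    Real.sqrt (∑ i, (softThresh lam b i - wstar i) ^ 2) ≤ 2 * Real.sqrt k * lam ∧
    ∑ i, |softThresh lam b i - wstar i| ≤ 2 * k * lam := by
  have herr (i : Fin p) :
      |softThresh lam b i - wstar i| ≤ if wstar i ≠ 0 then 2 * lam else 0 :=
    abs_softThresh_sub_le_ite hlam
      ((le_ciSup (f := fun i => |b i - wstar i|) (Set.finite_range _).bddAbove i).trans hfeas)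
  have hcard : ((Finset.univ.filter fun i => wstar i ≠ 0).card : ℝ) = k := by
    rw [← hsparse, ← Set.ncard_coe_finset]
    simp
  constructor
  · apply Real.sqrt_le_iff.2 ⟨by positivity, ?_⟩
    calc ∑ i, (softThresh lam b i - wstar i) ^ 2
        ≤ ∑ i, if wstar i ≠ 0 then (2 * lam) ^ 2 else 0 := by
          refine Finset.sum_le_sum fun i _ => ?_
          rw [← sq_abs]
          refine (pow_le_pow_left₀ (abs_nonneg _) (herr i) 2).trans_eq ?_
          split_ifs <;> simp
      _ = k * (2 * lam) ^ 2 := by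
          rw [← Finset.sum_filter, Finset.sum_const, nsmul_eq_mul, hcard]
      _ = (2 * Real.sqrt k * lam) ^ 2 := by
          rw [mul_pow, mul_pow, mul_pow, Real.sq_sqrt (Nat.cast_nonneg k)]
          ring
  · calc ∑ i, |softThresh lam b i - wstar i|
        ≤ ∑ i, if wstar i ≠ 0 then 2 * lam else 0 := Finset.sum_le_sum fun i _ => herr i
      _ = 2 * k * lam := by
          rw [← Finset.sum_filter, Finset.sum_const, nsmul_eq_mul, hcard]
          ring
end
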